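/- arXiv:0809.4679 — 12 statements merged into one kernel-verified Lean document; each statement's English description precedes it below -/
import Mathlib

section
/- For every μ ∈ (0,1), ln μ < 9(μ − 1) / (4(2μ + 1)). -/
theorem log_lt_of_mem_Ioo (μ : ℝ) (h0 : 0 < μ) (h1 : μ < 1) :
    Real.log μ < 9 * (μ - 1) / (4 * (2 * μ + 1)) := by
  have hd : ∀ x : ℝ, 0 < x → HasDerivAt
      (fun x : ℝ => Real.log x - 9 * (x - 1) / (4 * (2 * x + 1)))
      (x⁻¹ - ((9 * 1) * (4 * (2 * x + 1)) - 9 * (x - 1) * (4 * (2 * 1))) /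
        (4 * (2 * x + 1)) ^ 2) x := by
    intro x hx
    have hne : (4 * (2 * x + 1)) ≠ 0 := by positivity
    exact (Real.hasDerivAt_log hx.ne').sub
      ((((hasDerivAt_id' x).sub_const 1).const_mul 9).div
        ((((hasDerivAt_id' x).const_mul 2).add_const 1).const_mul 4) hne)
  have hm : StrictMonoOn (fun x : ℝ => Real.log x - 9 * (x - 1) / (4 * (2 * x + 1)))
      (Set.Ioi 0) := by
    apply strictMonoOn_of_deriv_pos (convex_Ioi 0)
    · intro x hx
      exact (hd x hx).continuousAt.continuousWithinAt
    · intro x hx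
      rw [interior_Ioi] at hx
      have hx : 0 < x := hx
      rw [(hd x hx).deriv, sub_pos, inv_eq_one_div, div_lt_div_iff₀ (by positivity) hx]
      nlinarith [sq_nonneg (32 * x - 11)]
  have h := hm (Set.mem_Ioi.2 h0) (Set.mem_Ioi.2 one_pos) h1
  norm_num at h
  linarith
end

section
/- For every μ ∈ (0,1), ln(1 − μ) < 9μ / (4(2μ − 3)). -/
theorem log_one_sub_lt_of_mem_Ioo (μ : ℝ) (h0 : 0 < μ) (h1 : μ < 1) :
    Real.log (1 - μ) < 9 * μ / (4 * (2 * μ - 3)) := by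
  obtain ⟨s, hs, hst⟩ : ∃ s : ℝ, 0 < s ∧ s ^ 2 = 1 - μ :=
    ⟨Real.sqrt (1 - μ), Real.sqrt_pos.mpr (by linarith), Real.sq_sqrt (by linarith)⟩
  have hs1 : s < 1 := by nlinarith
  have hμ : μ = 1 - s ^ 2 := by linarith
  have key := Real.le_log_one_add_of_nonneg (x := (1 - s) / s)
    (div_nonneg (by linarith) hs.le)
  have e1 : 1 + (1 - s) / s = s⁻¹ := by field_simp; ring
  have e2 : 2 * ((1 - s) / s) / ((1 - s) / s + 2) = 2 * (1 - s) / (1 + s) := by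
    have h : (1 - s) / s + 2 = (1 + s) / s := by field_simp; ring
    rw [h]
    field_simp
  rw [e1, e2, Real.log_inv] at key
  have e3 : Real.log (1 - μ) = 2 * Real.log s := by
    rw [← hst, Real.log_pow]; norm_num
  have e4 : 9 * μ / (4 * (2 * μ - 3)) = -(9 * (1 - s ^ 2) / (4 * (1 + 2 * s ^ 2))) := by
    have h : 4 * (2 * μ - 3) = -(4 * (1 + 2 * s ^ 2)) := by rw [hμ]; ring
    rw [h, div_neg, hμ]
  have e5 : 9 * (1 - s ^ 2) / (4 * (1 + 2 * s ^ 2)) < 2 * (2 * (1 - s) / (1 + s)) := by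
    rw [← mul_div_assoc, div_lt_div_iff₀ (by positivity) (by positivity)]
    have h : 0 < (1 - s) * (23 * s ^ 2 - 18 * s + 7) :=
      mul_pos (by linarith) (by nlinarith [sq_nonneg (23 * s - 9)])
    nlinarith [h]
  rw [e3, e4]
  linarith
end

section
/- Fix ε with 0 < ε < 1/2. The function z ↦ M(z, z − ε) is strictly increasing on the interval (ε, 1/2 + 2ε/3) and strictly decreasing on the interval (1/2 + 2ε/3, 1). -/
noncomputable def M (z μ : ℝ) : ℝ :=
  (μ - z) ^ 2 / (2 * (2 * μ / 3 + z / 3) * (2 * μ / 3 + z / 3 - 1))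

theorem M_aux (ε x y : ℝ) (hε : 0 < ε) (hx0 : 0 < x - 2 * ε / 3) (hx1 : x - 2 * ε / 3 < 1)
    (h : (x - 2 * ε / 3) * (1 - (x - 2 * ε / 3)) < (y - 2 * ε / 3) * (1 - (y - 2 * ε / 3))) :
    M x (x - ε) < M y (y - ε) := by
  have key : ∀ z : ℝ, M z (z - ε) =
      -(ε ^ 2 / (2 * ((z - 2 * ε / 3) * (1 - (z - 2 * ε / 3))))) := by
    intro z
    unfold M
    rw [← div_neg]
    congr 1 <;> ring
  rw [key, key]
  have hp : 0 < (x - 2 * ε / 3) * (1 - (x - 2 * ε / 3)) := mul_pos hx0 (by linarith)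
  apply neg_lt_neg
  apply div_lt_div_of_pos_left (by positivity) (by positivity) (by linarith)

theorem M_sub_eps_strictMonoOn_strictAntiOn (ε : ℝ) (hε : 0 < ε) (hε2 : ε < 1 / 2) :
    StrictMonoOn (fun z => M z (z - ε)) (Set.Ioo ε (1 / 2 + 2 * ε / 3)) ∧
    StrictAntiOn (fun z => M z (z - ε)) (Set.Ioo (1 / 2 + 2 * ε / 3) 1) := by 
  constructor
  · rintro x ⟨hx1, hx2⟩ y ⟨hy1, hy2⟩ hxy
    apply M_aux ε x y hε (by linarith) (by linarith)
    nlinarith [mul_pos (sub_pos.2 hxy) (show 0 < 1 - (x - 2 * ε / 3) - (y - 2 * ε / 3) by linarith)]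
  · rintro x ⟨hx1, hx2⟩ y ⟨hy1, hy2⟩ hxy
    apply M_aux ε y x hε (by linarith) (by linarith)
    nlinarith [mul_pos (sub_pos.2 hxy) (show 0 < (x - 2 * ε / 3) + (y - 2 * ε / 3) - 1 by linarith)]
end

section
/- Fix ε with 0 < ε < 1/2. Then M(z, z + ε) > M(z, z − ε) for every z ∈ (ε, 1/2), M(z, z + ε) = M(z, z − ε) at z = 1/2, and M(z, z + ε) < M(z, z − ε) for every z ∈ (1/2, 1 − ε). -/
lemma M_eq_neg (z s : ℝ) :
    M z (z + s) = -(s ^ 2 / (2 * ((z + 2 * s / 3) * (1 - (z + 2 * s / 3))))) := by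
  unfold M
  rw [← div_neg]
  congr 1 <;> ring

lemma M_lt_of (z s t : ℝ) (hst : s ^ 2 = t ^ 2) (hs : s ≠ 0)
    (h0 : 0 < (z + 2 * s / 3) * (1 - (z + 2 * s / 3)))
    (h : (z + 2 * s / 3) * (1 - (z + 2 * s / 3)) < (z + 2 * t / 3) * (1 - (z + 2 * t / 3))) :
    M z (z + s) < M z (z + t) := by
  rw [M_eq_neg, M_eq_neg, ← hst]
  apply neg_lt_neg
  exact div_lt_div_of_pos_left (by positivity) (by linarith) (by linarith)

theorem M_add_vs_sub_eps (ε : ℝ) (hε : 0 < ε) (hε2 : ε < 1 / 2) :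
    (∀ z ∈ Set.Ioo ε (1 / 2), M z (z + ε) > M z (z - ε)) ∧
    M (1 / 2) (1 / 2 + ε) = M (1 / 2) (1 / 2 - ε) ∧
    (∀ z ∈ Set.Ioo (1 / 2) (1 - ε), M z (z + ε) < M z (z - ε)) := by
  refine ⟨?_, ?_, ?_⟩
  · rintro z ⟨h1, h2⟩
    rw [gt_iff_lt, sub_eq_add_neg]
    apply M_lt_of z (-ε) ε (by ring) (by linarith)
    · apply mul_pos <;> linarith
    · nlinarith [mul_pos hε (sub_pos.2 h2)]
  · rw [sub_eq_add_neg, M_eq_neg, M_eq_neg]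
    congr 2 <;> ring
  · rintro z ⟨h1, h2⟩
    rw [sub_eq_add_neg]
    apply M_lt_of z ε (-ε) (by ring) hε.ne'
    · apply mul_pos <;> linarith
    · nlinarith [mul_pos hε (sub_pos.2 h1)]
end

section
/- Fix ε with 0 < ε < 1. Then M(z, z/(1 + ε)) > M(z, z/(1 − ε)) for every z with 0 < z < 1 − ε. -/
theorem M_div_one_add_gt_div_one_sub (ε : ℝ) (hε : 0 < ε) (hε1 : ε < 1) :
    ∀ z : ℝ, 0 < z → z < 1 - ε → M z (z / (1 + ε)) > M z (z / (1 - ε)) := by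
  intro z hz hz1
  have h1 : (0:ℝ) < 1 + ε := by linarith
  have h2 : (0:ℝ) < 1 - ε := by linarith
  have h3 : (0:ℝ) < 3 + ε := by linarith
  have h4 : (0:ℝ) < 3 - ε := by linarith
  have hA : 0 < 3 * (1 + ε) - z * (3 + ε) := by nlinarith
  have hB : 0 < 3 * (1 - ε) - z * (3 - ε) := by nlinarith [mul_pos hε h2]
  have e1 : M z (z / (1 + ε)) =
      -(9 * z * ε ^ 2 / (2 * ((3 + ε) * (3 * (1 + ε) - z * (3 + ε))))) := by
    have a1 : z / (1 + ε) - z = -(z * ε) / (1 + ε) := by field_simp; ring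
    have a2 : 2 * (z / (1 + ε)) / 3 + z / 3 = z * (3 + ε) / (3 * (1 + ε)) := by
      field_simp; ring
    have a3 : z * (3 + ε) / (3 * (1 + ε)) - 1
        = -(3 * (1 + ε) - z * (3 + ε)) / (3 * (1 + ε)) := by field_simp; ring
    unfold M
    rw [a1, a2, a3]
    generalize 3 * (1 + ε) - z * (3 + ε) = A at hA
    field_simp
    try ring
  have e2 : M z (z / (1 - ε)) =
      -(9 * z * ε ^ 2 / (2 * ((3 - ε) * (3 * (1 - ε) - z * (3 - ε))))) := by
    have a1 : z / (1 - ε) - z = (z * ε) / (1 - ε) := by field_simp; ring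
    have a2 : 2 * (z / (1 - ε)) / 3 + z / 3 = z * (3 - ε) / (3 * (1 - ε)) := by
      field_simp; ring
    have a3 : z * (3 - ε) / (3 * (1 - ε)) - 1
        = -(3 * (1 - ε) - z * (3 - ε)) / (3 * (1 - ε)) := by field_simp; ring
    unfold M
    rw [a1, a2, a3]
    generalize 3 * (1 - ε) - z * (3 - ε) = A at hB
    field_simp
    try ring
  rw [e1, e2]
  apply neg_lt_neg
  apply div_lt_div_of_pos_left
  · positivity
  · positivity
  · nlinarith [mul_pos hε (by linarith : (0:ℝ) < 2 - z)]
end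

section
/- If ε and μ are real numbers with 0 < ε < μ < 1/2 < 1 − ε, then M(μ − ε, μ) < M(μ + ε, μ). -/
theorem M_sub_lt_add (ε μ : ℝ) (hε : 0 < ε) (hεμ : ε < μ) (hμ : μ < 1 / 2)
    (hε2 : (1 : ℝ) / 2 < 1 - ε) :
    M (μ - ε) μ < M (μ + ε) μ := by
  have e1 : M (μ - ε) μ = -(ε ^ 2 / (2 * ((μ - ε / 3) * (1 - (μ - ε / 3))))) := by
    unfold M
    rw [← div_neg]
    congr 1 <;> ring
  have e2 : M (μ + ε) μ = -(ε ^ 2 / (2 * ((μ + ε / 3) * (1 - (μ + ε / 3))))) := by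
    unfold M
    rw [← div_neg]
    congr 1 <;> ring
  rw [e1, e2]
  apply neg_lt_neg
  have h1 : 0 < (μ - ε / 3) * (1 - (μ - ε / 3)) :=
    mul_pos (by linarith) (by linarith)
  apply div_lt_div_of_pos_left (by positivity) (by linarith)
  nlinarith [mul_pos hε (show 0 < 1 - 2 * μ by linarith)]
end

section
/- Fix ε with 0 < ε < 1. The function z ↦ M(z, z/(1 + ε)) is strictly decreasing on the interval (0, 1), and the function z ↦ M(z, z/(1 − ε)) is strictly decreasing on the interval (0, 1 − ε). -/
theorem M_aux_s11 (c x y : ℝ) (hc : 0 < c) (hc1 : c ≠ 1) (hx : 0 < x) (hxy : x < y)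
    (hy : (2 * c + 1) / 3 * y < 1) : M y (c * y) < M x (c * x) := by
  obtain ⟨k, hk⟩ : ∃ k, k = (2 * c + 1) / 3 := ⟨_, rfl⟩
  rw [← hk] at hy
  have hk0 : 0 < k := by rw [hk]; positivity
  have key : ∀ z, 0 < z → k * z < 1 →
      M z (c * z) = -((c - 1) ^ 2 / (2 * k) * (z / (1 - k * z))) := by
    intro z hz hkz
    have h1 : 2 * (c * z) / 3 + z / 3 = k * z := by rw [hk]; ring
    have h2 : 1 - k * z ≠ 0 := by linarith
    have h3 : k * z - 1 ≠ 0 := fun h => h2 (by linarith)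
    unfold M
    rw [h1, ← mul_div_mul_comm, ← neg_div, div_eq_div_iff (by positivity) (by positivity)]
    ring
  have hkx : k * x < k * y := mul_lt_mul_of_pos_left hxy hk0
  rw [key y (hx.trans hxy) hy, key x hx (hkx.trans hy)]
  have hA : 0 < (c - 1) ^ 2 / (2 * k) := by
    have : c - 1 ≠ 0 := sub_ne_zero.mpr hc1
    positivity
  apply neg_lt_neg
  apply mul_lt_mul_of_pos_left _ hA
  rw [div_lt_div_iff₀ (by linarith) (by linarith)]
  linarith [mul_comm x (k * y), mul_comm y (k * x), mul_left_comm x k y, mul_left_comm y k x, mul_comm x y]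

theorem M_div_strictAntiOn (ε : ℝ) (hε : 0 < ε) (hε1 : ε < 1) :
    StrictAntiOn (fun z => M z (z / (1 + ε))) (Set.Ioo 0 1) ∧
    StrictAntiOn (fun z => M z (z / (1 - ε))) (Set.Ioo 0 (1 - ε)) := by
  constructor
  · intro x hx y hy hxy
    have hc : (1 + ε)⁻¹ < 1 := inv_lt_one_of_one_lt₀ (by linarith)
    have hc0 : 0 < (1 + ε)⁻¹ := by positivity
    have h := M_aux_s11 (1 + ε)⁻¹ x y hc0 hc.ne hx.1 hxy (by nlinarith [hy.1, hy.2])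
    simpa only [div_eq_inv_mul] using h
  · intro x hx y hy hxy
    have he : 0 < 1 - ε := by linarith
    have hc : 1 < (1 - ε)⁻¹ := (one_lt_inv₀ he).mpr (by linarith)
    have h1 : (1 - ε)⁻¹ * y < 1 := by
      rw [inv_mul_lt_iff₀ he]; linarith [hy.2]
    have h := M_aux_s11 (1 - ε)⁻¹ x y (by positivity) hc.ne' hx.1 hxy (by linarith [hy.2])
    simpa only [div_eq_inv_mul] using h
end

section
/- For any fixed z ∈ (0,1), the function μ ↦ M(z, μ) is strictly increasing on the interval (0, z) and strictly decreasing on the interval (z, 1). Similarly, for any fixed μ ∈ (0,1), the function z ↦ M(z, μ) is strictly increasing on the interval (0, μ) and strictly decreasing on the interval (μ, 1). -/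
lemma M_eq (z μ : ℝ) (h1 : 0 < 2 * μ + z) (h2 : 0 < 3 - 2 * μ - z) :
    M z μ = -(9 / 2) * ((μ - z) / (2 * μ + z) * ((μ - z) / (3 - 2 * μ - z))) := by
  have e : 2 * (2 * μ / 3 + z / 3) * (2 * μ / 3 + z / 3 - 1)
      = -(2 / 9) * ((2 * μ + z) * (3 - 2 * μ - z)) := by ring
  unfold M
  rw [e, div_mul_div_comm, ← div_div]
  ring

lemma P_mu {z a b : ℝ} (hz : 0 < z) (ha : 0 < a) (hb : 0 < b) (h : a < b) :
    (a - z) / (2 * a + z) < (b - z) / (2 * b + z) := by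
  rw [div_lt_div_iff₀ (by linarith) (by linarith)]
  nlinarith [mul_pos hz (sub_pos.2 h)]

lemma Q_mu {z a b : ℝ} (hz : z < 1) (ha : a < 1) (hb : b < 1) (h : a < b) :
    (a - z) / (3 - 2 * a - z) < (b - z) / (3 - 2 * b - z) := by
  rw [div_lt_div_iff₀ (by linarith) (by linarith)]
  nlinarith [mul_pos (sub_pos.2 hz) (sub_pos.2 h)]

lemma P_z {μ a b : ℝ} (hz : 0 < μ) (ha : 0 < a) (hb : 0 < b) (h : a < b) :
    (μ - b) / (2 * μ + b) < (μ - a) / (2 * μ + a) := by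
  rw [div_lt_div_iff₀ (by linarith) (by linarith)]
  nlinarith [mul_pos hz (sub_pos.2 h)]

lemma Q_z {μ a b : ℝ} (hz : μ < 1) (ha : a < 1) (hb : b < 1) (h : a < b) :
    (μ - b) / (3 - 2 * μ - b) < (μ - a) / (3 - 2 * μ - a) := by
  rw [div_lt_div_iff₀ (by linarith) (by linarith)]
  nlinarith [mul_pos (sub_pos.2 hz) (sub_pos.2 h)]

lemma prod_pos_lt {p q p' q' : ℝ} (hp : 0 < p) (hq : 0 < q) (h : p < p') (h' : q < q') :
    -(9 / 2) * (p' * q') < -(9 / 2) * (p * q) := by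
  nlinarith [mul_pos hp (sub_pos.2 h'), mul_pos (hq.trans h') (sub_pos.2 h)]

lemma prod_neg_lt {p q p' q' : ℝ} (hp : p' < 0) (hq : q' < 0) (h : p < p') (h' : q < q') :
    -(9 / 2) * (p * q) < -(9 / 2) * (p' * q') := by
  have := prod_pos_lt (neg_pos.2 hp) (neg_pos.2 hq) (neg_lt_neg h) (neg_lt_neg h')
  simpa using this

theorem M_monotonicity :
    (∀ z ∈ Set.Ioo (0 : ℝ) 1,
      StrictMonoOn (fun μ => M z μ) (Set.Ioo 0 z) ∧
      StrictAntiOn (fun μ => M z μ) (Set.Ioo z 1)) ∧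
    (∀ μ ∈ Set.Ioo (0 : ℝ) 1,
      StrictMonoOn (fun z => M z μ) (Set.Ioo 0 μ) ∧
      StrictAntiOn (fun z => M z μ) (Set.Ioo μ 1)) := by
  refine ⟨fun z ⟨hz0, hz1⟩ => ⟨?_, ?_⟩, fun μ ⟨hm0, hm1⟩ => ⟨?_, ?_⟩⟩ <;>
    rintro a ⟨ha0, ha1⟩ b ⟨hb0, hb1⟩ hab <;> dsimp only <;>
    rw [M_eq _ _ (by linarith) (by linarith), M_eq _ _ (by linarith) (by linarith)]
  · exact prod_neg_lt (div_neg_of_neg_of_pos (by linarith) (by linarith))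
      (div_neg_of_neg_of_pos (by linarith) (by linarith))
      (P_mu hz0 ha0 hb0 hab) (Q_mu hz1 (by linarith) (by linarith) hab)
  · exact prod_pos_lt (div_pos (by linarith) (by linarith))
      (div_pos (by linarith) (by linarith))
      (P_mu hz0 (by linarith) (by linarith) hab) (Q_mu hz1 ha1 hb1 hab)
  · exact prod_pos_lt (div_pos (by linarith) (by linarith))
      (div_pos (by linarith) (by linarith))
      (P_z hm0 ha0 hb0 hab) (Q_z hm1 (by linarith) (by linarith) hab)
  · exact prod_neg_lt (div_neg_of_neg_of_pos (by linarith) (by linarith))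
      (div_neg_of_neg_of_pos (by linarith) (by linarith))
      (P_z hm0 (by linarith) (by linarith) hab) (Q_z hm1 ha1 hb1 hab)
end

section
/- Fix ε with 0 < ε < 1. Then M_I(z, z/(1 + ε)) > M_I(z, z/(1 − ε)) for every z with 0 < z < 1 − ε. -/
noncomputable def MI (z μ : ℝ) : ℝ := M z μ / z

theorem MI_formula (e z : ℝ) (hz : 0 < z) (h1 : 0 < 1 + e) (h3 : 0 < 3 + e)
    (h : 0 < 3 * (1 + e) - z * (3 + e)) :
    MI z (z / (1 + e)) = -(9 * e ^ 2 / (2 * ((3 + e) * (3 * (1 + e) - z * (3 + e))))) := by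
  have a1 : z / (1 + e) - z = -(z * e) / (1 + e) := by field_simp; ring
  have a2 : 2 * (z / (1 + e)) / 3 + z / 3 = z * (3 + e) / (3 * (1 + e)) := by field_simp; ring
  have a3 : z * (3 + e) / (3 * (1 + e)) - 1 = -(3 * (1 + e) - z * (3 + e)) / (3 * (1 + e)) := by
    field_simp; ring
  unfold MI M
  rw [a1, a2, a3]
  generalize 3 * (1 + e) - z * (3 + e) = w at *
  field_simp
  try ring

theorem MI_div_one_add_gt_div_one_sub (ε : ℝ) (hε : 0 < ε) (hε1 : ε < 1) :
    ∀ z : ℝ, 0 < z → z < 1 - ε → MI z (z / (1 + ε)) > MI z (z / (1 - ε)) := by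
  intro z hz hz1
  have h2 : 0 < 3 * (1 + -ε) - z * (3 + -ε) := by nlinarith
  have h1 : 0 < 3 * (1 + ε) - z * (3 + ε) := by nlinarith
  rw [sub_eq_add_neg 1 ε, MI_formula ε z hz (by linarith) (by linarith) h1,
    MI_formula (-ε) z hz (by linarith) (by linarith) h2, neg_sq]
  have hp : 0 < (3 + -ε) * (3 * (1 + -ε) - z * (3 + -ε)) := mul_pos (by linarith) h2
  have hlt : (3 + -ε) * (3 * (1 + -ε) - z * (3 + -ε)) < (3 + ε) * (3 * (1 + ε) - z * (3 + ε)) := by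
    nlinarith [mul_pos hε (show 0 < 2 - z by linarith)]
  apply neg_lt_neg
  exact div_lt_div_of_pos_left (by positivity) (by linarith) (by linarith)
end

section
/- For any fixed z ∈ (0,1), the function μ ↦ M_I(z, μ) is strictly increasing on the interval (0, z) and strictly decreasing on the interval (z, 1). -/
/-- Comparison of two quotients with negative denominators. -/
theorem quot_compare (a b u v : ℝ) (hu : 0 < u) (hu1 : u < 1) (hv : 0 < v) (hv1 : v < 1)
    (h : a ^ 2 * (v * (1 - v)) < b ^ 2 * (u * (1 - u))) :
    b ^ 2 / (2 * v * (v - 1)) < a ^ 2 / (2 * u * (u - 1)) := by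
  have e1 : b ^ 2 / (2 * v * (v - 1)) = -(b ^ 2 / (2 * (v * (1 - v)))) := by
    rw [← div_neg]; congr 1; ring
  have e2 : a ^ 2 / (2 * u * (u - 1)) = -(a ^ 2 / (2 * (u * (1 - u)))) := by
    rw [← div_neg]; congr 1; ring
  have p1 : 0 < u * (1 - u) := mul_pos hu (by linarith)
  have p2 : 0 < v * (1 - v) := mul_pos hv (by linarith)
  rw [e1, e2, neg_lt_neg_iff, div_lt_div_iff₀ (by positivity) (by positivity)]
  linarith

theorem MI_monotonicity_in_mu (z : ℝ) (hz : z ∈ Set.Ioo (0 : ℝ) 1) :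
    StrictMonoOn (fun μ => MI z μ) (Set.Ioo 0 z) ∧
    StrictAntiOn (fun μ => MI z μ) (Set.Ioo z 1) := by
  obtain ⟨h0, h1⟩ := hz
  constructor
  · rintro x ⟨hx0, hxz⟩ y ⟨hy0, hyz⟩ hxy
    refine div_lt_div_of_pos_right ?_ h0
    refine quot_compare _ _ _ _ (by linarith) (by linarith) (by linarith) (by linarith) ?_
    have k1 : (z - y) * (2 * x / 3 + z / 3) < (z - x) * (2 * y / 3 + z / 3) := by
      nlinarith [mul_pos h0 (sub_pos.2 hxy)]
    have k2 : (z - y) * (1 - (2 * x / 3 + z / 3)) < (z - x) * (1 - (2 * y / 3 + z / 3)) := by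
      nlinarith [mul_pos (sub_pos.2 h1) (sub_pos.2 hxy)]
    have := mul_lt_mul'' k1 k2 (mul_nonneg (by linarith) (by linarith))
      (mul_nonneg (by linarith) (by linarith))
    linarith
  · rintro x ⟨hxz, hx1⟩ y ⟨hyz, hy1⟩ hxy
    refine div_lt_div_of_pos_right ?_ h0
    refine quot_compare _ _ _ _ (by linarith) (by linarith) (by linarith) (by linarith) ?_
    have k1 : (x - z) * (2 * y / 3 + z / 3) < (y - z) * (2 * x / 3 + z / 3) := by
      nlinarith [mul_pos h0 (sub_pos.2 hxy)]
    have k2 : (x - z) * (1 - (2 * y / 3 + z / 3)) < (y - z) * (1 - (2 * x / 3 + z / 3)) := by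
      nlinarith [mul_pos (sub_pos.2 h1) (sub_pos.2 hxy)]
    have := mul_lt_mul'' k1 k2 (mul_nonneg (by linarith) (by linarith))
      (mul_nonneg (by linarith) (by linarith))
    linarith
end

section
/- Let 0 < ε < 1/2, let p ∈ (0,1), let n be a positive integer, and let c < 0 be a real number. If z ∈ [0,1] satisfies z ≤ p − ε and (|z − 1/2| − 2ε/3)² ≥ 1/4 + n·ε²/(2c), then z < p and M(z, p) ≤ c/n. -/
theorem le_sub_eps_decision_implies (ε p c : ℝ) (n : ℕ) (hε : 0 < ε) (hε2 : ε < 1 / 2)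
    (hp : p ∈ Set.Ioo (0 : ℝ) 1) (hn : 0 < n) (hc : c < 0) (z : ℝ)
    (hz : z ∈ Set.Icc (0 : ℝ) 1) (h1 : z ≤ p - ε)
    (h2 : (|z - 1 / 2| - 2 * ε / 3) ^ 2 ≥ 1 / 4 + n * ε ^ 2 / (2 * c)) :
    z < p ∧ M z p ≤ c / n := by
  obtain ⟨hp0, hp1⟩ := hp
  obtain ⟨hz0, hz1⟩ := hz
  have hzp : z < p := by linarith
  refine ⟨hzp, ?_⟩
  have hn' : (0 : ℝ) < n := by exact_mod_cast hn
  obtain ⟨w, hw⟩ : ∃ w, w = z + 2 * ε / 3 := ⟨_, rfl⟩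
  obtain ⟨v, hv⟩ : ∃ v, v = 2 * p / 3 + z / 3 := ⟨_, rfl⟩
  have hv0 : 0 < v := by linarith
  have hv1 : v < 1 := by linarith
  have hw0 : 0 < w := by linarith
  have hw1 : w < 1 := by linarith
  have h3 : (w - 1 / 2) ^ 2 ≥ 1 / 4 + n * ε ^ 2 / (2 * c) := by
    refine le_trans h2 ?_
    rw [hw]
    rcases le_total z (1 / 2) with h | h
    · rw [abs_of_nonpos (by linarith)]
      apply le_of_eq; ring
    · rw [abs_of_nonneg (by linarith)]
      nlinarith [mul_nonneg (sub_nonneg.2 h) hε.le]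
  have h4 : w * (1 - w) * (2 * -c) ≤ n * ε ^ 2 := by
    have h5 : w * (1 - w) ≤ n * ε ^ 2 / (2 * -c) := by
      have : (n : ℝ) * ε ^ 2 / (2 * -c) = -(n * ε ^ 2 / (2 * c)) := by
        rw [mul_neg, div_neg]
      rw [this]; nlinarith
    exact (le_div_iff₀ (by linarith)).1 h5
  have a1 : ε * v ≤ (p - z) * w := by
    rw [hv, hw]; nlinarith [mul_nonneg (show 0 ≤ p - z - ε by linarith) hz0]
  have a2 : ε * (1 - v) ≤ (p - z) * (1 - w) := by
    rw [hv, hw]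
    nlinarith [mul_nonneg (show 0 ≤ p - z - ε by linarith) (show 0 ≤ 1 - z by linarith)]
  have a3 : (ε * v) * (ε * (1 - v)) ≤ ((p - z) * w) * ((p - z) * (1 - w)) :=
    mul_le_mul a1 a2 (mul_nonneg hε.le (by linarith))
      (mul_nonneg (by linarith) hw0.le)
  have a4 := mul_le_mul_of_nonneg_right a3 (show 0 ≤ 2 * -c by linarith)
  have a5 := mul_le_mul_of_nonneg_left h4 (sq_nonneg (p - z))
  have key : v * (1 - v) * (2 * -c) ≤ n * (p - z) ^ 2 := by
    have : ε ^ 2 * (v * (1 - v) * (2 * -c)) ≤ ε ^ 2 * (n * (p - z) ^ 2) := by linarith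
    exact le_of_mul_le_mul_left this (by positivity)
  have hvv : 0 < 2 * v * (1 - v) := mul_pos (by linarith) (by linarith)
  unfold M
  rw [← hv]
  have e : (p - z) ^ 2 / (2 * v * (v - 1)) = -((p - z) ^ 2 / (2 * v * (1 - v))) := by
    rw [← div_neg]; congr 1; ring
  have e2 : c / n = -(-c / n) := by ring
  rw [e, e2, neg_le_neg_iff, div_le_div_iff₀ hn' hvv]
  linarith
end

section
/- Let 0 < ε < 1/2, let p ∈ (0,1), let n be a positive integer, and let c < 0 be a real number. If z ∈ [0,1] satisfies z ≥ p + ε and (|z − 1/2| − 2ε/3)² ≥ 1/4 + n·ε²/(2c), then z > p and M(z, p) ≤ c/n. -/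
theorem ge_add_eps_decision_implies (ε p c : ℝ) (n : ℕ) (hε : 0 < ε) (hε2 : ε < 1 / 2)
    (hp : p ∈ Set.Ioo (0 : ℝ) 1) (hn : 0 < n) (hc : c < 0) (z : ℝ)
    (hz : z ∈ Set.Icc (0 : ℝ) 1) (h1 : z ≥ p + ε)
    (h2 : (|z - 1 / 2| - 2 * ε / 3) ^ 2 ≥ 1 / 4 + n * ε ^ 2 / (2 * c)) :
    z > p ∧ M z p ≤ c / n := by
  obtain ⟨hp0, hp1⟩ := hp
  obtain ⟨hz0, hz1⟩ := hz
  refine ⟨by linarith, ?_⟩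
  have hN : (0 : ℝ) < n := by exact_mod_cast hn
  obtain ⟨w, hw⟩ : ∃ w, w = 2 * p / 3 + z / 3 := ⟨_, rfl⟩
  obtain ⟨v, hv⟩ : ∃ v, v = z - 2 * ε / 3 := ⟨_, rfl⟩
  have hw0 : 0 < w := by linarith
  have hw1 : w < 1 := by linarith
  have hv0 : 0 < v := by linarith
  have hv1 : v < 1 := by linarith
  have h3 : (|z - 1 / 2| - 2 * ε / 3) ^ 2 ≤ (v - 1 / 2) ^ 2 := by
    rcases abs_cases (z - 1 / 2) with ⟨h, h'⟩ | ⟨h, h'⟩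
    · rw [h, hv]; apply le_of_eq; ring
    · rw [h, hv]; nlinarith
  have h4 : n * ε ^ 2 / (2 * c) ≤ -(v * (1 - v)) := by nlinarith
  rw [div_le_iff_of_neg (by linarith)] at h4
  have h5 : ε * w ≤ (z - p) * v := by rw [hw, hv]; nlinarith
  have h6 : ε * (1 - w) ≤ (z - p) * (1 - v) := by rw [hw, hv]; nlinarith
  have h7 := mul_le_mul h5 h6 (mul_nonneg hε.le (by linarith))
    (mul_nonneg (by linarith) hv0.le)
  have h8 : ε ^ 2 * (-2 * c * (w * (1 - w))) ≤ ε ^ 2 * (n * (z - p) ^ 2) := by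
    have a := mul_le_mul_of_nonneg_left h7 (by linarith : 0 ≤ -2 * c)
    have b := mul_le_mul_of_nonneg_left h4 (sq_nonneg (z - p))
    linarith
  have h9 := le_of_mul_le_mul_left h8 (by positivity)
  unfold M
  rw [← hw, div_le_iff_of_neg (by nlinarith), div_mul_eq_mul_div, div_le_iff₀ hN]
  linarith
end
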